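/- Let L(λ) := M_{τ_1}(Y_1) M_{σ_1}(X_1) (λ M_τ^P − M_σ^P) M_{σ_2}(X_2) M_{τ_2}(Y_2) = λL_1 − L_0 be an EGFP of P(λ). Suppose P(λ) is regular and ∞ is an eigenvalue of P(λ) (i.e., A_m is singular; hence −m ∈ τ). Let Z be an mn×k matrix with rank(Z) = k. If the columns of Z form a basis of the right eigenspace of L(λ) at ∞ (i.e., of N_r(L_1)), then: (a) if c_{−m}(τ) < m, the columns of (e^T_{c_{−m}(τ,τ_2)+1} ⊗ I_n) Z form a basis of the right eigenspace of P(λ) at ∞ (i.e., of N_r(A_m)); (b) if c_{−m}(τ) = m, the columns of A_0^{−1}(e^T_m ⊗ I_n) Z form a basis of N_r(A_m). If the columns of Z form a basis of the left eigenspace of L(λ) at ∞ (i.e., of N_l(L_1)), then: (c) if i_{−m}(τ) < m, the columns of (e^T_{i_{−m}(τ_1,τ)+1} ⊗ I_n) Z form a basis of the left eigenspace of P(λ) at ∞ (i.e., of N_l(A_m)); (d) if i_{−m}(τ) = m, the columns of A_0^{−T}(e^T_m ⊗ I_n) Z form a basis of N_l(A_m). -/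

import Mathlib

open Matrix Polynomial

/-- Signed indices: `pos k` denotes `k` and `neg k` denotes `−k`, with `−0` and `0` distinct. -/
inductive SIdx : Type where
  | pos : ℕ → SIdx
  | neg : ℕ → SIdx
deriving DecidableEq

namespace SIdx

/-- The absolute value of a signed index. -/
def val : SIdx → ℕ
  | pos k => k
  | neg k => k

/-- Whether a signed index is negative. -/
def isNeg : SIdx → Bool
  | pos _ => false
  | neg _ => true

/-- The successor `t + 1` of a signed index (`−s + 1 = −(s−1)`). -/
def succ : SIdx → SIdx
  | pos k => pos (k + 1)
  | neg 0 => pos 0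
  | neg (k + 1) => neg k

/-- Negation of a signed index. -/
def negate : SIdx → SIdx
  | pos k => neg k
  | neg k => pos k

end SIdx

/-- The ascending chain `(t, t+1, …, t+p)`. -/
def chainUp (t : SIdx) : ℕ → List SIdx
  | 0 => [t]
  | p + 1 => t :: chainUp t.succ p

/-- The number of consecutions `c_t(α)` of the index tuple `α` at `t` (`−1` when `t ∉ α`):
the largest `p` such that `(t, t+1, …, t+p)` is a subtuple (sublist) of `α`. -/
noncomputable def consAt (α : List SIdx) (t : SIdx) : ℤ :=
  letI := Classical.decPred (fun p : ℕ => (chainUp t p).Sublist α)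
  if t ∈ α then (Nat.findGreatest (fun p : ℕ => (chainUp t p).Sublist α) α.length : ℤ) else -1

/-- The number of inversions `i_t(α)` of the index tuple `α` at `t` (`−1` when `t ∉ α`):
the largest `q` such that `(t+q, …, t+1, t)` is a subtuple (sublist) of `α`. -/
noncomputable def invsAt (α : List SIdx) (t : SIdx) : ℤ :=
  letI := Classical.decPred (fun p : ℕ => ((chainUp t p).reverse).Sublist α)
  if t ∈ α then (Nat.findGreatest (fun p : ℕ => ((chainUp t p).reverse).Sublist α) α.length : ℤ)
  else -1

/-- The Successor Infix Property: between any two equal entries there is an occurrence of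
their successor. -/
def SIP (α : List SIdx) : Prop :=
  ∀ a b : Fin α.length, a < b → α.get a = α.get b →
    ∃ c : Fin α.length, a < c ∧ c < b ∧ α.get c = (α.get a).succ

/-- The `mn × mn` elementary matrix `M_k(X)` (viewed as an `m × m` block matrix with
`n × n` blocks): `M_0(X) = M_{−0}(X) = diag(I_{(m−1)n}, X)`,
`M_m(X) = M_{−m}(X) = diag(X, I_{(m−1)n})`, and for `1 ≤ i ≤ m−1` the matrix `M_i(X)`
(resp. `M_{−i}(X)`) is the identity except for the 2×2 block submatrix
`[[X, I],[I, 0]]` (resp. `[[0, I],[I, X]]`) in block rows/columns `(m−i, m−i+1)`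
(1-indexed). -/
noncomputable def elemMat (m n : ℕ) (k : SIdx) (X : Matrix (Fin n) (Fin n) ℂ) :
    Matrix (Fin m × Fin n) (Fin m × Fin n) ℂ := fun p q =>
  if k.val = 0 then
    if p.1 = q.1 then (if (p.1 : ℕ) = m - 1 then X p.2 q.2 else if p.2 = q.2 then 1 else 0)
    else 0
  else if k.val = m then
    if p.1 = q.1 then (if (p.1 : ℕ) = 0 then X p.2 q.2 else if p.2 = q.2 then 1 else 0)
    else 0
  else
    if (p.1 : ℕ) = m - k.val - 1 ∧ (q.1 : ℕ) = m - k.val - 1 then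
      (if k.isNeg then 0 else X p.2 q.2)
    else if ((p.1 : ℕ) = m - k.val - 1 ∧ (q.1 : ℕ) = m - k.val) ∨
        ((p.1 : ℕ) = m - k.val ∧ (q.1 : ℕ) = m - k.val - 1) then
      (if p.2 = q.2 then 1 else 0)
    else if (p.1 : ℕ) = m - k.val ∧ (q.1 : ℕ) = m - k.val then
      (if k.isNeg then X p.2 q.2 else 0)
    else if p = q then 1 else 0

/-- `M_t(X) = M_{t_1}(X_1) ⋯ M_{t_r}(X_r)` for an index tuple `t` with matrix assignment `Xs`. -/
noncomputable def prodAssign (m n : ℕ) (t : List SIdx) (Xs : List (Matrix (Fin n) (Fin n) ℂ)) :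
    Matrix (Fin m × Fin n) (Fin m × Fin n) ℂ :=
  ((t.zip Xs).map fun p => elemMat m n p.1 p.2).prod

/-- The trivial (Fiedler) matrix assignment of `P(λ) = Σ λ^i A_i`:
`M_i^P = M_i(−A_i)` for `0 ≤ i ≤ m−1`, `M_m^P = (M_{−m}^P)⁻¹ = M_m(A_m⁻¹)`,
`M_{−i}^P = M_{−i}(A_i)` for `1 ≤ i ≤ m`, and `M_{−0}^P = (M_0^P)⁻¹ = M_{−0}((−A_0)⁻¹)`. -/
noncomputable def fiedlerX (m : ℕ) {n : ℕ} (A : ℕ → Matrix (Fin n) (Fin n) ℂ) :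
    SIdx → Matrix (Fin n) (Fin n) ℂ
  | .pos i => if i = m then (A m)⁻¹ else -A i
  | .neg i => if i = 0 then (-A 0)⁻¹ else A i

/-- `M_t^P`, the product of Fiedler matrices of `P` along the index tuple `t`. -/
noncomputable def prodFiedler (m n : ℕ) (A : ℕ → Matrix (Fin n) (Fin n) ℂ) (t : List SIdx) :
    Matrix (Fin m × Fin n) (Fin m × Fin n) ℂ :=
  (t.map fun k => elemMat m n k (fiedlerX m A k)).prod

/-- A nonsingular matrix assignment: the matrices assigned to positions with indices
`±0` or `±m` are nonsingular. -/
def NonsingAssign (m : ℕ) {n : ℕ} (t : List SIdx) (Xs : List (Matrix (Fin n) (Fin n) ℂ)) :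
    Prop :=
  t.length = Xs.length ∧ ∀ p ∈ t.zip Xs, (p.1.val = 0 ∨ p.1.val = m) → IsUnit p.2

/-- The data of an extended generalized Fiedler pencil (EGFP)
`L(λ) = M_{τ₁}(Y₁) M_{σ₁}(X₁) (λ M_τ^P − M_σ^P) M_{σ₂}(X₂) M_{τ₂}(Y₂)`
of the `n × n` matrix polynomial `P(λ) = Σ_{i=0}^m λ^i A_i` of degree `m ≥ 2`. -/
structure EGFPData (m n : ℕ) where
  /-- coefficients of `P` -/
  A : ℕ → Matrix (Fin n) (Fin n) ℂ
  sig : List SIdx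
  tau : List SIdx
  sig1 : List SIdx
  sig2 : List SIdx
  tau1 : List SIdx
  tau2 : List SIdx
  X1 : List (Matrix (Fin n) (Fin n) ℂ)
  X2 : List (Matrix (Fin n) (Fin n) ℂ)
  Y1 : List (Matrix (Fin n) (Fin n) ℂ)
  Y2 : List (Matrix (Fin n) (Fin n) ℂ)
  hm : 2 ≤ m
  hAm : A m ≠ 0
  hsigpos : ∀ k ∈ sig, k.isNeg = false
  htauneg : ∀ k ∈ tau, k.isNeg = true
  /-- `(σ, ω)` is a permutation of `{0, 1, …, m}`, where `τ = −ω`. -/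
  hperm : List.Perm (sig.map SIdx.val ++ tau.map SIdx.val) (List.range (m + 1))
  hsig1 : ∀ k ∈ sig1, k ∈ sig ∧ k.val + 2 ≤ m
  hsig2 : ∀ k ∈ sig2, k ∈ sig ∧ k.val + 2 ≤ m
  htau1 : ∀ k ∈ tau1, k ∈ tau ∧ 2 ≤ k.val
  htau2 : ∀ k ∈ tau2, k ∈ tau ∧ 2 ≤ k.val
  hSIPsig : SIP (sig1 ++ sig ++ sig2)
  hSIPtau : SIP (tau1 ++ tau ++ tau2)
  hX1 : NonsingAssign m sig1 X1
  hX2 : NonsingAssign m sig2 X2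
  hY1 : NonsingAssign m tau1 Y1
  hY2 : NonsingAssign m tau2 Y2
  hA0 : SIdx.neg 0 ∈ tau → IsUnit (A 0)
  hAmUnit : SIdx.pos m ∈ sig → IsUnit (A m)

namespace EGFPData

variable {m n : ℕ}

/-- `M_{τ₁}(Y₁) M_{σ₁}(X₁)`. -/
noncomputable def leftFac (E : EGFPData m n) : Matrix (Fin m × Fin n) (Fin m × Fin n) ℂ :=
  prodAssign m n E.tau1 E.Y1 * prodAssign m n E.sig1 E.X1

/-- `M_{σ₂}(X₂) M_{τ₂}(Y₂)`. -/
noncomputable def rightFac (E : EGFPData m n) : Matrix (Fin m × Fin n) (Fin m × Fin n) ℂ :=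
  prodAssign m n E.sig2 E.X2 * prodAssign m n E.tau2 E.Y2

/-- The coefficient `L₁` of `λ` in `L(λ) = λ L₁ − L₀`. -/
noncomputable def L1 (E : EGFPData m n) : Matrix (Fin m × Fin n) (Fin m × Fin n) ℂ :=
  E.leftFac * prodFiedler m n E.A E.tau * E.rightFac

/-- The constant term `L₀` in `L(λ) = λ L₁ − L₀`. -/
noncomputable def L0 (E : EGFPData m n) : Matrix (Fin m × Fin n) (Fin m × Fin n) ℂ :=
  E.leftFac * prodFiedler m n E.A E.sig * E.rightFac

end EGFPData

/-- The `(i, j)` block (of size `n × n`) of an `mn × mn` matrix. -/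
def blockOf {m n : ℕ} (M : Matrix (Fin m × Fin n) (Fin m × Fin n) ℂ) (i j : Fin m) :
    Matrix (Fin n) (Fin n) ℂ := fun p q => M (i, p) (j, q)

/-- Block penta-diagonal: all blocks `B_{ij}` with `|i − j| > 2` vanish. -/
def BlockPenta {m n : ℕ} (M : Matrix (Fin m × Fin n) (Fin m × Fin n) ℂ) : Prop :=
  ∀ i j : Fin m, ((i : ℕ) + 2 < (j : ℕ) ∨ (j : ℕ) + 2 < (i : ℕ)) → blockOf M i j = 0

/-- Block tridiagonal: all blocks `B_{ij}` with `|i − j| > 1` vanish. -/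
def BlockTri {m n : ℕ} (M : Matrix (Fin m × Fin n) (Fin m × Fin n) ℂ) : Prop :=
  ∀ i j : Fin m, ((i : ℕ) + 1 < (j : ℕ) ∨ (j : ℕ) + 1 < (i : ℕ)) → blockOf M i j = 0

/-- `e_j^T ⊗ I_n` as an `n × mn` matrix, for a 1-indexed block index `j`
(zero when `j` is out of range). -/
def rowSel (m n : ℕ) (j : ℤ) : Matrix (Fin n) (Fin m × Fin n) ℂ :=
  fun p q => if ((q.1 : ℕ) : ℤ) + 1 = j ∧ p = q.2 then 1 else 0

/-- `e_j ⊗ I_n` as an `mn × n` matrix, for a 1-indexed block index `j`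
(zero when `j` is out of range). -/
def colSel (m n : ℕ) (j : ℤ) : Matrix (Fin m × Fin n) (Fin n) ℂ :=
  fun p q => if ((p.1 : ℕ) : ℤ) + 1 = j ∧ p.2 = q then 1 else 0

/-- The matrix polynomial `P(λ) = Σ_{i=0}^m λ^i A_i` as an `n × n` matrix over `ℂ[λ]`. -/
noncomputable def polyP (m n : ℕ) (A : ℕ → Matrix (Fin n) (Fin n) ℂ) :
    Matrix (Fin n) (Fin n) (Polynomial ℂ) := fun p q =>
  ∑ i ∈ Finset.range (m + 1), Polynomial.C (A i p q) * Polynomial.X ^ i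

/-- The columns of `Z` form a basis of the right null space `N_r(M)`. -/
def ColsBasisKerRight {α β : Type*} [Fintype β] {k : ℕ} (M : Matrix α β ℂ)
    (Z : Matrix β (Fin k) ℂ) : Prop :=
  (∀ j, M.mulVec (fun i => Z i j) = 0) ∧
  LinearIndependent ℂ (fun j : Fin k => fun i => Z i j) ∧
  ∀ x : β → ℂ, M.mulVec x = 0 →
    x ∈ Submodule.span ℂ (Set.range fun j : Fin k => fun i => Z i j)

/-- The columns of `Z` form a basis of the left null space `N_l(M)`. -/
def ColsBasisKerLeft {α β : Type*} [Fintype α] {k : ℕ} (M : Matrix α β ℂ)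
    (Z : Matrix α (Fin k) ℂ) : Prop :=
  (∀ j, Matrix.vecMul (fun i => Z i j) M = 0) ∧
  LinearIndependent ℂ (fun j : Fin k => fun i => Z i j) ∧
  ∀ y : α → ℂ, Matrix.vecMul y M = 0 →
    y ∈ Submodule.span ℂ (Set.range fun j : Fin k => fun i => Z i j)

/-! ### Block vectors -/

/-- The `j`-th block (0-indexed) of a block vector, zero out of range. -/
def blk {m n : ℕ} (v : Fin m × Fin n → ℂ) (j : ℕ) : Fin n → ℂ :=
  fun a => if h : j < m then v (⟨j, h⟩, a) else 0

theorem blk_ext {m n : ℕ} {v w : Fin m × Fin n → ℂ} (h : ∀ j < m, blk v j = blk w j) : v = w := by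
  funext ⟨j, a⟩
  have := congrFun (h j j.2) a
  simpa [blk] using this

theorem blk_zero {m n : ℕ} (j : ℕ) : blk (0 : Fin m × Fin n → ℂ) j = 0 := by
  funext a; simp [blk]

theorem row_formula {m n : ℕ} (M : Matrix (Fin m × Fin n) (Fin m × Fin n) ℂ)
    (v : Fin m × Fin n → ℂ) (j s t : ℕ) (hj : j < m) (hs : s < m) (ht : t < m)
    (B C : Matrix (Fin n) (Fin n) ℂ)
    (h : ∀ (a : Fin n) (q : Fin m) (b : Fin n), M (⟨j, hj⟩, a) (q, b) =
      (if (q : ℕ) = s then B a b else 0) + (if (q : ℕ) = t then C a b else 0)) :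
    blk (M *ᵥ v) j = B *ᵥ blk v s + C *ᵥ blk v t := by
  have key : ∀ (s : ℕ) (hs : s < m) (B : Matrix (Fin n) (Fin n) ℂ) (a : Fin n),
      ∑ q : Fin m, ∑ b : Fin n, (if (q : ℕ) = s then B a b else 0) * v (q, b)
        = (B *ᵥ blk v s) a := by
    intro s hs B a
    rw [Finset.sum_eq_single (⟨s, hs⟩ : Fin m)]
    · simp [Matrix.mulVec, dotProduct, blk, hs]
    · intro q _ hq
      have : (q : ℕ) ≠ s := fun h => hq (Fin.ext h)
      simp [this]
    · simp
  funext a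
  simp only [Pi.add_apply]
  rw [← key s hs, ← key t ht, ← Finset.sum_add_distrib]
  simp only [blk, hj, dite_true, Matrix.mulVec, dotProduct, Fintype.sum_prod_type, h,
    ← Finset.sum_add_distrib, add_mul]

theorem blk_elem_zero {m n : ℕ} (k : SIdx) (hk : k.val = 0) (X : Matrix (Fin n) (Fin n) ℂ)
    (v : Fin m × Fin n → ℂ) (j : ℕ) (hj : j < m) :
    blk (elemMat m n k X *ᵥ v) j = if j = m - 1 then X *ᵥ blk v j else blk v j := by
  split_ifs with h
  · rw [row_formula _ v j j j hj hj hj X 0]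
    · simp
    · intro a q b
      have e : (⟨j, hj⟩ : Fin m) = q ↔ (q : ℕ) = j := by rw [Fin.ext_iff, eq_comm]
      simp [elemMat, hk, h, e]
      grind
  · rw [row_formula _ v j j j hj hj hj 1 0]
    · simp
    · intro a q b
      have e : (⟨j, hj⟩ : Fin m) = q ↔ (q : ℕ) = j := by rw [Fin.ext_iff, eq_comm]
      simp [elemMat, hk, h, e, Matrix.one_apply, Matrix.zero_apply]

theorem blk_elem_m {m n : ℕ} (hm : 2 ≤ m) (k : SIdx) (hk : k.val = m)
    (X : Matrix (Fin n) (Fin n) ℂ)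
    (v : Fin m × Fin n → ℂ) (j : ℕ) (hj : j < m) :
    blk (elemMat m n k X *ᵥ v) j = if j = 0 then X *ᵥ blk v j else blk v j := by
  have hm0 : m ≠ 0 := by omega
  split_ifs with h
  · rw [row_formula _ v j j j hj hj hj X 0]
    · simp
    · intro a q b
      have e : (⟨j, hj⟩ : Fin m) = q ↔ (q : ℕ) = j := by rw [Fin.ext_iff, eq_comm]
      simp only [elemMat, hk, hm0, e, Matrix.zero_apply]
      grind
  · rw [row_formula _ v j j j hj hj hj 1 0]
    · simp
    · intro a q b
      have e : (⟨j, hj⟩ : Fin m) = q ↔ (q : ℕ) = j := by rw [Fin.ext_iff, eq_comm]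
      simp [elemMat, hk, h, e, hm0, Matrix.one_apply, Matrix.zero_apply]

theorem blk_elem_neg {m n : ℕ} (i : ℕ) (hi0 : 0 < i) (him : i < m)
    (X : Matrix (Fin n) (Fin n) ℂ)
    (v : Fin m × Fin n → ℂ) (j : ℕ) (hj : j < m) :
    blk (elemMat m n (.neg i) X *ᵥ v) j =
      if j = m - i - 1 then blk v (m - i) else
      if j = m - i then blk v (m - i - 1) + X *ᵥ blk v (m - i) else blk v j := by
  have e1 : i ≠ 0 := by omega
  have e2 : i ≠ m := by omega
  have e3 : m - i ≠ m - i - 1 := by omega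
  split_ifs with h h'
  · rw [row_formula _ v j (m - i) j hj (by omega) hj 1 0]
    · simp
    · intro a q b
      have e : (⟨j, hj⟩ : Fin m) = q ↔ (q : ℕ) = j := by rw [Fin.ext_iff, eq_comm]
      simp only [elemMat, SIdx.val, SIdx.isNeg, Prod.mk.injEq, e, e1, e2, Matrix.one_apply, Matrix.zero_apply]
      grind
  · rw [row_formula _ v j (m - i - 1) (m - i) hj (by omega) (by omega) 1 X]
    · simp
    · intro a q b
      have e : (⟨j, hj⟩ : Fin m) = q ↔ (q : ℕ) = j := by rw [Fin.ext_iff, eq_comm]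
      simp only [elemMat, SIdx.val, SIdx.isNeg, Prod.mk.injEq, e, e1, e2, Matrix.one_apply, Matrix.zero_apply]
      grind
  · rw [row_formula _ v j j j hj (by omega) hj 1 0]
    · simp
    · intro a q b
      have e : (⟨j, hj⟩ : Fin m) = q ↔ (q : ℕ) = j := by rw [Fin.ext_iff, eq_comm]
      simp only [elemMat, SIdx.val, SIdx.isNeg, Prod.mk.injEq, e, e1, e2, Matrix.one_apply, Matrix.zero_apply]
      grind

theorem blk_elem_pos {m n : ℕ} (i : ℕ) (hi0 : 0 < i) (him : i < m)
    (X : Matrix (Fin n) (Fin n) ℂ)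
    (v : Fin m × Fin n → ℂ) (j : ℕ) (hj : j < m) :
    blk (elemMat m n (.pos i) X *ᵥ v) j =
      if j = m - i - 1 then X *ᵥ blk v (m - i - 1) + blk v (m - i) else
      if j = m - i then blk v (m - i - 1) else blk v j := by
  have e1 : i ≠ 0 := by omega
  have e2 : i ≠ m := by omega
  have e3 : m - i ≠ m - i - 1 := by omega
  split_ifs with h h'
  · rw [row_formula _ v j (m - i - 1) (m - i) hj (by omega) (by omega) X 1]
    · simp
    · intro a q b
      have e : (⟨j, hj⟩ : Fin m) = q ↔ (q : ℕ) = j := by rw [Fin.ext_iff, eq_comm]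
      simp only [elemMat, SIdx.val, SIdx.isNeg, Prod.mk.injEq, e, e1, e2, Matrix.one_apply, Matrix.zero_apply]
      grind
  · rw [row_formula _ v j (m - i - 1) j hj (by omega) hj 1 0]
    · simp
    · intro a q b
      have e : (⟨j, hj⟩ : Fin m) = q ↔ (q : ℕ) = j := by rw [Fin.ext_iff, eq_comm]
      simp only [elemMat, SIdx.val, SIdx.isNeg, Prod.mk.injEq, e, e1, e2, Matrix.one_apply, Matrix.zero_apply]
      grind
  · rw [row_formula _ v j j j hj (by omega) hj 1 0]
    · simp
    · intro a q b
      have e : (⟨j, hj⟩ : Fin m) = q ↔ (q : ℕ) = j := by rw [Fin.ext_iff, eq_comm]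
      simp only [elemMat, SIdx.val, SIdx.isNeg, Prod.mk.injEq, e, e1, e2, Matrix.one_apply, Matrix.zero_apply]
      grind

theorem isUnit_of_ker {ι : Type*} [Fintype ι] [DecidableEq ι] (M : Matrix ι ι ℂ)
    (h : ∀ v, M *ᵥ v = 0 → v = 0) : IsUnit M := by
  rw [← Matrix.mulVec_injective_iff_isUnit]
  intro v w hvw
  have : M *ᵥ (v - w) = 0 := by rw [Matrix.mulVec_sub]; simpa [sub_eq_zero] using hvw
  exact sub_eq_zero.mp (h _ this)

theorem ker_of_isUnit {ι : Type*} [Fintype ι] [DecidableEq ι] {M : Matrix ι ι ℂ}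
    (hM : IsUnit M) {v : ι → ℂ} (h : M *ᵥ v = 0) : v = 0 := by
  have hi := Matrix.mulVec_injective_iff_isUnit.mpr hM
  apply hi
  simpa using h

theorem isUnit_elemMat {m n : ℕ} (hm : 2 ≤ m) (k : SIdx) (hk : k.val ≤ m)
    (X : Matrix (Fin n) (Fin n) ℂ) (hX : (k.val = 0 ∨ k.val = m) → IsUnit X) :
    IsUnit (elemMat m n k X) := by
  apply isUnit_of_ker
  intro v hv
  have hb : ∀ j, blk (elemMat m n k X *ᵥ v) j = 0 := by intro j; rw [hv, blk_zero]
  apply blk_ext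
  intro j hj
  rw [blk_zero]
  by_cases h0 : k.val = 0
  · have := hb j
    rw [blk_elem_zero k h0 X v j hj] at this
    split_ifs at this
    · exact ker_of_isUnit (hX (Or.inl h0)) this
    · exact this
  by_cases h1 : k.val = m
  · have := hb j
    rw [blk_elem_m hm k h1 X v j hj] at this
    split_ifs at this
    · exact ker_of_isUnit (hX (Or.inr h1)) this
    · exact this
  cases k with
  | pos i =>
    simp only [SIdx.val] at *
    have hf := fun j hj => (blk_elem_pos i (by omega) (by omega) X v j hj).symm.trans (hb j)
    have f2 := hf (m - i) (by omega)
    have f1 := hf (m - i - 1) (by omega)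
    have e3 : m - i ≠ m - i - 1 := by omega
    simp only [e3, if_true, if_false] at f1 f2
    rw [f2] at f1
    simp only [Matrix.mulVec_zero, zero_add] at f1
    have f3 := hf j hj
    split_ifs at f3 with c1 c2
    · rw [c1, f2]
    · rw [c2, f1]
    · exact f3
  | neg i =>
    simp only [SIdx.val] at *
    have hf := fun j hj => (blk_elem_neg i (by omega) (by omega) X v j hj).symm.trans (hb j)
    have f2 := hf (m - i) (by omega)
    have f1 := hf (m - i - 1) (by omega)
    have e3 : m - i ≠ m - i - 1 := by omega
    simp only [e3, if_true, if_false] at f1 f2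
    rw [f1] at f2
    simp only [Matrix.mulVec_zero, add_zero] at f2
    have f3 := hf j hj
    split_ifs at f3 with c1 c2
    · rw [c1, f2]
    · rw [c2, f1]
    · exact f3

theorem elemMat_transpose {m n : ℕ} (k : SIdx) (X : Matrix (Fin n) (Fin n) ℂ) :
    (elemMat m n k X)ᵀ = elemMat m n k Xᵀ := by
  ext ⟨p, a⟩ ⟨q, b⟩
  simp only [elemMat, Matrix.transpose_apply, Prod.mk.injEq]
  grind

/-! ### Combinatorics of index tuples -/

/-- The length of the greedy chain `t, t+1, …` found in a list. -/
def runLen : SIdx → List SIdx → ℕ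
  | _, [] => 0
  | t, k :: l => if k = t then runLen t.succ l + 1 else runLen t l

theorem chain_sublist_iff (l : List SIdx) : ∀ (t : SIdx) (p : ℕ),
    (chainUp t p).Sublist l ↔ p < runLen t l := by
  induction l with
  | nil => intro t p; cases p <;> simp [chainUp, runLen]
  | cons k l ih =>
    intro t p
    by_cases hk : k = t
    · subst hk
      cases p with
      | zero => simp [chainUp, runLen]
      | succ p => simp [chainUp, runLen, ih]
    · have hk' : t ≠ k := fun h => hk h.symm
      have : runLen t (k :: l) = runLen t l := by simp [runLen, hk]
      rw [this, ← ih]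
      cases p with
      | zero =>
        simp only [chainUp, List.singleton_sublist, List.mem_cons, hk', false_or]
      | succ p =>
        simp only [chainUp]
        constructor
        · intro h
          cases h with
          | cons _ h => exact h
          | cons_cons _ h => exact absurd rfl hk
        · intro h; exact h.cons _

theorem runLen_le (l : List SIdx) : ∀ t, runLen t l ≤ l.length := by
  induction l with
  | nil => intro t; simp [runLen]
  | cons k l ih =>
    intro t
    simp only [runLen, List.length_cons]
    split_ifs
    · exact Nat.succ_le_succ (ih _)
    · exact (ih _).trans (Nat.le_succ _)

theorem consAt_eq (l : List SIdx) (t : SIdx) : consAt l t = (runLen t l : ℤ) - 1 := by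
  have hmem : t ∈ l ↔ 0 < runLen t l := by
    rw [← chain_sublist_iff]; simp [chainUp]
  unfold consAt
  by_cases h : t ∈ l
  · rw [if_pos h]
    have h0 := hmem.mp h
    have hl := runLen_le l t
    have : @Nat.findGreatest (fun p : ℕ => (chainUp t p).Sublist l) (Classical.decPred _) l.length
        = runLen t l - 1 := by
      refine (@Nat.findGreatest_eq_iff _ _ _ (Classical.decPred _)).mpr ⟨by omega, ?_, ?_⟩
      · intro _; rw [chain_sublist_iff]; omega
      · intro n hn _; rw [chain_sublist_iff]; omega
    rw [this]; omega
  · rw [if_neg h]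
    have : ¬ 0 < runLen t l := fun h' => h (hmem.mpr h')
    omega

theorem invsAt_eq (l : List SIdx) (t : SIdx) : invsAt l t = consAt l.reverse t := by
  unfold invsAt consAt
  simp only [List.mem_reverse, List.length_reverse]
  have : (fun p : ℕ => (chainUp t p).reverse.Sublist l)
      = (fun p : ℕ => (chainUp t p).Sublist l.reverse) := by
    funext p
    rw [← List.reverse_sublist, List.reverse_reverse]
  simp only [this]
  congr!

theorem runLen_mem (l : List SIdx) : ∀ (q j : ℕ), j < runLen (.neg q) l → j ≤ q →
    SIdx.neg (q - j) ∈ l := by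
  induction l with
  | nil => intro q j h; simp [runLen] at h
  | cons k l ih =>
    intro q j h hj
    simp only [runLen] at h
    split_ifs at h with hk
    · rcases j with _ | j
      · simp [hk]
      · obtain ⟨q, rfl⟩ : ∃ q', q = q' + 1 := ⟨q - 1, by omega⟩
        have := ih q j (by simpa [SIdx.succ] using h) (by omega)
        simp only [Nat.add_sub_add_right]
        exact List.mem_cons_of_mem _ this
    · exact List.mem_cons_of_mem _ (ih q j h hj)

/-- Every occurrence of `t` in `l` is preceded by an occurrence of `t + 1`. -/
def Guard (t : SIdx) (l : List SIdx) : Prop :=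
  ∀ l2 l3, l = l2 ++ t :: l3 → t.succ ∈ l2

/-- List form of the successor infix property. -/
def SIPL (l : List SIdx) : Prop :=
  ∀ l1 t l', l = l1 ++ t :: l' → Guard t l'

theorem SIP.toL {l : List SIdx} (h : SIP l) : SIPL l := by
  intro l1 t l' e l2 l3 e'
  subst e'
  subst e
  obtain ⟨c, h1, h2, h3⟩ := h ⟨l1.length, by simp⟩ ⟨l1.length + 1 + l2.length, by simp; omega⟩
    (by simp [Fin.lt_def]; omega) (by grind)
  have h1' : l1.length < c.1 := h1
  have h2' : c.1 < l1.length + 1 + l2.length := h2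
  have hidx : c.1 - l1.length - 1 < l2.length := by omega
  have hc : (l1 ++ t :: (l2 ++ t :: l3)).get c = l2[c.1 - l1.length - 1] := by
    simp only [List.get_eq_getElem]
    grind
  have h4 : (l1 ++ t :: (l2 ++ t :: l3)).get ⟨l1.length, by simp⟩ = t := by simp
  rw [hc, h4] at h3
  rw [← h3]
  exact List.getElem_mem _

theorem SIP.rev {l : List SIdx} (h : SIP l) : SIP l.reverse := by
  intro a b hab e
  have ha := a.2
  have hb := b.2
  have hab' : a.1 < b.1 := hab
  simp only [List.length_reverse] at ha hb
  obtain ⟨c, h1, h2, h3⟩ := h ⟨l.length - 1 - b, by omega⟩ ⟨l.length - 1 - a, by omega⟩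
    (by simp only [Fin.lt_def]; omega) (by simpa using e.symm)
  have h1' : l.length - 1 - b < c.1 := h1
  have h2' : c.1 < l.length - 1 - a := h2
  refine ⟨⟨l.length - 1 - c, by simp; omega⟩, ?_, ?_, ?_⟩
  · simp only [Fin.lt_def]; omega
  · simp only [Fin.lt_def]; omega
  · have hcc : l.length - 1 - (l.length - 1 - c.1) = c.1 := by omega
    have e' : l[l.length - 1 - a.1] = l[l.length - 1 - b.1] := by simpa using e
    simp only [List.get_eq_getElem, List.getElem_reverse, hcc, e'] at h3 ⊢
    exact h3

theorem SIPL.tail {a b : List SIdx} (h : SIPL (a ++ b)) : SIPL b := by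
  intro l1 t l' e
  exact h (a ++ l1) t l' (by rw [e, List.append_assoc])

theorem runLen_append (a b : List SIdx) : ∀ q, runLen (.neg q) a ≤ q →
    runLen (.neg q) (a ++ b) = runLen (.neg q) a + runLen (.neg (q - runLen (.neg q) a)) b := by
  induction a with
  | nil => intro q _; simp [runLen]
  | cons k a ih =>
    intro q hq
    simp only [runLen, List.cons_append] at hq ⊢
    split_ifs at hq ⊢ with hk
    · obtain ⟨q, rfl⟩ : ∃ q', q = q' + 1 := ⟨q - 1, by omega⟩
      simp only [SIdx.succ] at hq ⊢
      rw [ih q (by omega), Nat.add_sub_add_right]; omega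
    · exact ih q hq

/-! ### Propagation of the distinguished block -/

/-- Product of elementary matrices along a list of (index, matrix) pairs. -/
noncomputable def elemProd (m n : ℕ) (l : List (SIdx × Matrix (Fin n) (Fin n) ℂ)) :
    Matrix (Fin m × Fin n) (Fin m × Fin n) ℂ :=
  (l.map fun p => elemMat m n p.1 p.2).prod

theorem elemProd_cons {m n : ℕ} (a : SIdx × Matrix (Fin n) (Fin n) ℂ)
    (l : List (SIdx × Matrix (Fin n) (Fin n) ℂ)) :
    elemProd m n (a :: l) = elemMat m n a.1 a.2 * elemProd m n l := by
  simp [elemProd]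

theorem elemProd_append {m n : ℕ} (l l' : List (SIdx × Matrix (Fin n) (Fin n) ℂ)) :
    elemProd m n (l ++ l') = elemProd m n l * elemProd m n l' := by
  simp [elemProd]

theorem isUnit_elemProd {m n : ℕ} (hm : 2 ≤ m) (l : List (SIdx × Matrix (Fin n) (Fin n) ℂ))
    (h : ∀ k ∈ l, k.1.val ≤ m ∧ ((k.1.val = 0 ∨ k.1.val = m) → IsUnit k.2)) :
    IsUnit (elemProd m n l) := by
  induction l with
  | nil => simp [elemProd]
  | cons a l ih =>
    rw [elemProd_cons]
    exact (isUnit_elemMat hm _ (h a (by simp)).1 _ (h a (by simp)).2).mul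
      (ih fun k hk => h k (by simp [hk]))

/-- Block `p` of `v` is `x` and all later blocks vanish. -/
def AtBlock {m n : ℕ} (p : ℕ) (x : Fin n → ℂ) (v : Fin m × Fin n → ℂ) : Prop :=
  blk v p = x ∧ ∀ j, p < j → j < m → blk v j = 0

theorem step_adv {m n : ℕ} {p : ℕ} {x : Fin n → ℂ} {w : Fin m × Fin n → ℂ}
    {X : Matrix (Fin n) (Fin n) ℂ} (hp : p + 1 < m)
    (h : AtBlock p x (elemMat m n (.neg (m - 1 - p)) X *ᵥ w)) : AtBlock (p + 1) x w := by
  obtain ⟨h1, h2⟩ := h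
  have hf := fun j hj => blk_elem_neg (m - 1 - p) (by omega) (by omega) X w j hj
  have e1 : m - (m - 1 - p) = p + 1 := by omega
  simp only [e1, Nat.add_sub_cancel] at hf
  constructor
  · rw [← h1, hf p (by omega)]; simp
  · intro j hj hjm
    have := h2 j (by omega) hjm
    rw [hf j hjm] at this
    rwa [if_neg (by omega), if_neg (by omega)] at this

theorem step_stay {m n : ℕ} (hm : 2 ≤ m) {p i : ℕ} {x : Fin n → ℂ} {w : Fin m × Fin n → ℂ}
    {X : Matrix (Fin n) (Fin n) ℂ} (hp : p < m) (hi : i ≤ m) (h0 : i = 0 → IsUnit X)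
    (hi1 : i ≠ m - 1 - p) (hi2 : i ≠ m - p)
    (h : AtBlock p x (elemMat m n (.neg i) X *ᵥ w)) : AtBlock p x w := by
  obtain ⟨h1, h2⟩ := h
  by_cases c0 : i = 0
  · have hf := fun j hj => blk_elem_zero (.neg i) (by simpa [SIdx.val] using c0) X w j hj
    constructor
    · rw [← h1, hf p hp, if_neg (by omega)]
    · intro j hj hjm
      have := h2 j hj hjm
      rw [hf j hjm] at this
      split_ifs at this
      · exact ker_of_isUnit (h0 c0) this
      · exact this
  by_cases cm : i = m
  · have hf := fun j hj => blk_elem_m hm (.neg i) (by simpa [SIdx.val] using cm) X w j hj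
    constructor
    · rw [← h1, hf p hp, if_neg (by omega)]
    · intro j hj hjm
      have := h2 j hj hjm
      rwa [hf j hjm, if_neg (by omega)] at this
  have hf := fun j hj => blk_elem_neg i (by omega) (by omega) X w j hj
  constructor
  · rw [← h1, hf p hp, if_neg (by omega), if_neg (by omega)]
  · intro j hj hjm
    by_cases hlt : m - i < p
    · have := h2 j hj hjm
      rwa [hf j hjm, if_neg (by omega), if_neg (by omega)] at this
    have f1 := (hf (m - i - 1) (by omega)).symm.trans (h2 _ (by omega) (by omega))
    have f2 := (hf (m - i) (by omega)).symm.trans (h2 _ (by omega) (by omega))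
    have f3 := (hf j hjm).symm.trans (h2 _ hj hjm)
    have e3 : m - i ≠ m - i - 1 := by omega
    simp only [e3, if_true, if_false] at f1 f2
    rw [f1] at f2
    simp only [Matrix.mulVec_zero, add_zero] at f2
    split_ifs at f3 with c1 c2
    · rw [c1, f2]
    · rw [c2, f1]
    · exact f3

theorem step_pos {m n : ℕ} {p i : ℕ} {x : Fin n → ℂ} {w : Fin m × Fin n → ℂ}
    {X : Matrix (Fin n) (Fin n) ℂ} (h0 : i = 0 → IsUnit X)
    (hi : i + p + 2 ≤ m)
    (h : AtBlock p x (elemMat m n (.pos i) X *ᵥ w)) : AtBlock p x w := by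
  obtain ⟨h1, h2⟩ := h
  by_cases c0 : i = 0
  · have hf := fun j hj => blk_elem_zero (.pos i) (by simpa [SIdx.val] using c0) X w j hj
    constructor
    · rw [← h1, hf p (by omega), if_neg (by omega)]
    · intro j hj hjm
      have := h2 j hj hjm
      rw [hf j hjm] at this
      split_ifs at this
      · exact ker_of_isUnit (h0 c0) this
      · exact this
  have hf := fun j hj => blk_elem_pos i (by omega) (by omega) X w j hj
  constructor
  · rw [← h1, hf p (by omega), if_neg (by omega), if_neg (by omega)]
  · intro j hj hjm
    have f1 := (hf (m - i - 1) (by omega)).symm.trans (h2 _ (by omega) (by omega))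
    have f2 := (hf (m - i) (by omega)).symm.trans (h2 _ (by omega) (by omega))
    have f3 := (hf j hjm).symm.trans (h2 _ hj hjm)
    have e3 : m - i ≠ m - i - 1 := by omega
    simp only [e3, if_true, if_false] at f1 f2
    rw [f2] at f1
    simp only [Matrix.mulVec_zero, zero_add] at f1
    split_ifs at f3 with c1 c2
    · rw [c1, f2]
    · rw [c2, f1]
    · exact f3

theorem pos_run {m n : ℕ} {p : ℕ} {x : Fin n → ℂ}
    (l : List (SIdx × Matrix (Fin n) (Fin n) ℂ)) :
    ∀ (w : Fin m × Fin n → ℂ),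
    (∀ k ∈ l, ∃ i, k.1 = .pos i ∧ i + p + 2 ≤ m ∧ (i = 0 → IsUnit k.2)) →
    AtBlock p x (elemProd m n l *ᵥ w) → AtBlock p x w := by
  induction l with
  | nil => intro w _ h; simpa [elemProd] using h
  | cons a l ih =>
    intro w hl h
    rw [elemProd_cons, ← Matrix.mulVec_mulVec] at h
    obtain ⟨i, h1, h2, h3⟩ := hl a (by simp)
    rw [h1] at h
    exact ih w (fun k hk => hl k (by simp [hk])) (step_pos h3 h2 h)

theorem neg_run {m n : ℕ} (hm : 2 ≤ m) {x : Fin n → ℂ} (rest : List SIdx)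
    (l : List (SIdx × Matrix (Fin n) (Fin n) ℂ)) :
    ∀ (p : ℕ) (w : Fin m × Fin n → ℂ),
    (∀ k ∈ l, ∃ i, k.1 = .neg i ∧ i ≤ m ∧ (i = 0 → IsUnit k.2)) →
    SIPL (l.map Prod.fst ++ rest) → Guard (.neg (m - p)) (l.map Prod.fst ++ rest) →
    p + runLen (.neg (m - 1 - p)) (l.map Prod.fst) < m →
    AtBlock p x (elemProd m n l *ᵥ w) →
    AtBlock (p + runLen (.neg (m - 1 - p)) (l.map Prod.fst)) x w ∧
      Guard (.neg (m - (p + runLen (.neg (m - 1 - p)) (l.map Prod.fst)))) rest := by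
  induction l with
  | nil =>
    intro p w _ _ hg _ h
    simp only [List.map_nil, runLen, Nat.add_zero, List.nil_append] at *
    exact ⟨by simpa [elemProd] using h, hg⟩
  | cons a l ih =>
    intro p w hl hs hg hlt h
    rw [elemProd_cons, ← Matrix.mulVec_mulVec] at h
    obtain ⟨i, h1, h2, h3⟩ := hl a (by simp)
    rw [h1] at h
    simp only [List.map_cons, List.cons_append, h1, runLen] at hs hg hlt ⊢
    have hl' : ∀ k ∈ l, ∃ i, k.1 = SIdx.neg i ∧ i ≤ m ∧ (i = 0 → IsUnit k.2) :=
      fun k hk => hl k (by simp [hk])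
    have hs' : SIPL (l.map Prod.fst ++ rest) := SIPL.tail (a := [SIdx.neg i]) hs
    by_cases hi : i = m - 1 - p
    · subst hi
      simp only [if_true] at hlt ⊢
      have hp : p + 1 < m := by omega
      have hsucc : (SIdx.neg (m - 1 - p)).succ = .neg (m - 1 - (p + 1)) := by
        have : m - 1 - p = (m - 1 - (p + 1)) + 1 := by omega
        rw [this]; rfl
      rw [hsucc] at hlt ⊢
      have e : m - 1 - p = m - (p + 1) := by omega
      have hg' : Guard (.neg (m - (p + 1))) (l.map Prod.fst ++ rest) :=
        hs [] _ _ (by rw [e]; rfl)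
      have := ih (p + 1) w hl' hs' hg' (by omega) (step_adv hp h)
      have e2 : p + (runLen (.neg (m - 1 - (p + 1))) (l.map Prod.fst) + 1)
        = p + 1 + runLen (.neg (m - 1 - (p + 1))) (l.map Prod.fst) := by omega
      rw [e2]
      exact this
    · have hne : ¬ SIdx.neg i = SIdx.neg (m - 1 - p) := fun h => hi (SIdx.neg.inj h)
      simp only [hne, if_false] at hlt ⊢
      have hi2 : i ≠ m - p := by
        intro e
        subst e
        have := hg [] _ rfl
        simp at this
      have hsucc : (SIdx.neg (m - p)).succ = .neg (m - 1 - p) := by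
        have : m - p = (m - 1 - p) + 1 := by omega
        rw [this]; rfl
      have hg' : Guard (.neg (m - p)) (l.map Prod.fst ++ rest) := by
        intro l2 l3 e
        have := hg (SIdx.neg i :: l2) l3 (by rw [e]; rfl)
        rw [hsucc] at this ⊢
        rcases List.mem_cons.mp this with h | h
        · exact absurd h.symm hne
        · exact h
      exact ih p w hl' hs' hg' hlt (step_stay hm (by omega) h2 h3 hi hi2 h)

/-- The full chain of Fiedler factors ending in `M_{-0}^P`. -/
theorem chain_run {m n : ℕ} (A : ℕ → Matrix (Fin n) (Fin n) ℂ) (hA : IsUnit (A 0))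
    (q : ℕ) : ∀ (w : Fin m × Fin n → ℂ), q < m →
    blk w (m - 1) = -(A 0 *ᵥ blk (elemProd m n
      ((chainUp (.neg q) q).map fun k => (k, fiedlerX m A k)) *ᵥ w) (m - 1 - q)) := by
  induction q with
  | zero =>
    intro w hq
    have hd := (Matrix.isUnit_iff_isUnit_det _).mp hA
    have : IsUnit (-A 0) := hA.neg
    have hd' := (Matrix.isUnit_iff_isUnit_det _).mp this
    simp only [chainUp, List.map_cons, List.map_nil, elemProd, List.prod_cons, List.prod_nil,
      mul_one, fiedlerX, if_true, Nat.sub_zero]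
    rw [blk_elem_zero _ rfl _ _ _ (by omega), if_pos rfl, ← Matrix.neg_mulVec,
      Matrix.mulVec_mulVec, Matrix.mul_nonsing_inv _ hd', Matrix.one_mulVec]
  | succ q ih =>
    intro w hq
    rw [ih w (by omega)]
    simp only [chainUp, List.map_cons, SIdx.succ, elemProd_cons, ← Matrix.mulVec_mulVec]
    rw [blk_elem_neg (q + 1) (by omega) hq _ _ _ (by omega), if_pos (by omega)]
    have : m - (q + 1) = m - 1 - q := by omega
    rw [this]

/-- Factors with indices of absolute value at least two do not change the last block. -/
theorem last_run {m n : ℕ} (hm : 2 ≤ m) (l : List (SIdx × Matrix (Fin n) (Fin n) ℂ)) :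
    ∀ (w : Fin m × Fin n → ℂ),
    (∀ k ∈ l, ∃ i, k.1 = .neg i ∧ i ≤ m ∧ 2 ≤ i) →
    blk (elemProd m n l *ᵥ w) (m - 1) = blk w (m - 1) := by
  induction l with
  | nil => intro w _; simp [elemProd]
  | cons a l ih =>
    intro w hl
    rw [elemProd_cons, ← Matrix.mulVec_mulVec]
    obtain ⟨i, h1, h2, h3⟩ := hl a (by simp)
    rw [h1, ← ih w (fun k hk => hl k (by simp [hk]))]
    by_cases hi : i = m
    · rw [blk_elem_m hm _ (by simpa [SIdx.val] using hi) _ _ _ (by omega), if_neg (by omega)]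
    · rw [blk_elem_neg i (by omega) (by omega) _ _ _ (by omega), if_neg (by omega),
        if_neg (by omega)]

/-! ### Bases -/

theorem basis_transfer {β γ : Type*} [Fintype β] [Fintype γ] {k : ℕ} (L : Matrix β β ℂ)
    (A : Matrix γ γ ℂ) (R : Matrix γ β ℂ) (Z : Matrix β (Fin k) ℂ)
    (h1 : ∀ z, L *ᵥ z = 0 → A *ᵥ (R *ᵥ z) = 0)
    (h2 : ∀ z, L *ᵥ z = 0 → R *ᵥ z = 0 → z = 0)
    (h3 : ∀ x, A *ᵥ x = 0 → ∃ z, L *ᵥ z = 0 ∧ R *ᵥ z = x)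
    (hZ : ColsBasisKerRight L Z) : ColsBasisKerRight A (R * Z) := by
  obtain ⟨z1, z2, z3⟩ := hZ
  have hcol : ∀ j, (fun i => (R * Z) i j) = R.mulVecLin (fun i => Z i j) := by
    intro j; rfl
  have he : (fun j : Fin k => fun i => (R * Z) i j)
      = R.mulVecLin ∘ (fun j : Fin k => fun i => Z i j) := funext hcol
  refine ⟨?_, ?_, ?_⟩
  · intro j
    rw [hcol]
    exact h1 _ (z1 j)
  · have hd : Disjoint (Submodule.span ℂ (Set.range fun j : Fin k => fun i => Z i j))
        (LinearMap.ker R.mulVecLin) := by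
      rw [Submodule.disjoint_def]
      intro z hz hz'
      have hle : Submodule.span ℂ (Set.range fun j : Fin k => fun i => Z i j)
          ≤ LinearMap.ker L.mulVecLin := by
        rw [Submodule.span_le]
        rintro _ ⟨j, rfl⟩
        exact z1 j
      exact h2 z (hle hz) hz'
    have h4 := z2.map hd
    rw [he]
    exact h4
  · intro x hx
    obtain ⟨z, hz, rfl⟩ := h3 x hx
    have := Submodule.mem_map_of_mem (f := R.mulVecLin) (z3 z hz)
    rw [Submodule.map_span, ← Set.range_comp] at this
    rw [he]
    exact this

theorem basis_of_core {m n k : ℕ} (hm : 2 ≤ m)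
    (L W : Matrix (Fin m × Fin n) (Fin m × Fin n) ℂ)
    (A : Matrix (Fin n) (Fin n) ℂ) (R : Matrix (Fin n) (Fin m × Fin n) ℂ)
    (Z : Matrix (Fin m × Fin n) (Fin k) ℂ) (hW : IsUnit W)
    (hL : ∀ z, L *ᵥ z = 0 ↔ A *ᵥ blk (W *ᵥ z) 0 = 0 ∧ ∀ j, 0 < j → j < m → blk (W *ᵥ z) j = 0)
    (c : ℂ) (hc : c ≠ 0)
    (hR : ∀ z x, AtBlock 0 x (W *ᵥ z) → R *ᵥ z = c • x)
    (hZ : ColsBasisKerRight L Z) : ColsBasisKerRight A (R * Z) := by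
  apply basis_transfer L A R Z _ _ _ hZ
  · intro z hz
    obtain ⟨e1, e2⟩ := (hL z).mp hz
    rw [hR z _ ⟨rfl, e2⟩, Matrix.mulVec_smul, e1, smul_zero]
  · intro z hz hz'
    obtain ⟨e1, e2⟩ := (hL z).mp hz
    rw [hR z _ ⟨rfl, e2⟩] at hz'
    have h0 : blk (W *ᵥ z) 0 = 0 := (smul_eq_zero.mp hz').resolve_left hc
    apply ker_of_isUnit hW
    apply blk_ext
    intro j hj
    rw [blk_zero]
    rcases Nat.eq_zero_or_pos j with rfl | hj0
    · exact h0
    · exact e2 j hj0 hj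
  · intro x hx
    let u : Fin m × Fin n → ℂ := fun q => if (q.1 : ℕ) = 0 then c⁻¹ * x q.2 else 0
    have hu0 : blk u 0 = c⁻¹ • x := by
      funext a
      simp [blk, u, show 0 < m by omega]
    have hu : ∀ j, 0 < j → j < m → blk u j = 0 := by
      intro j hj hjm
      funext a
      simp [blk, u, hjm, show j ≠ 0 by omega]
    have hWz : W *ᵥ (W⁻¹ *ᵥ u) = u := by
      rw [Matrix.mulVec_mulVec,
        Matrix.mul_nonsing_inv _ ((Matrix.isUnit_iff_isUnit_det _).mp hW), Matrix.one_mulVec]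
    refine ⟨W⁻¹ *ᵥ u, ?_, ?_⟩
    · rw [hL, hWz]
      exact ⟨by rw [hu0, Matrix.mulVec_smul, hx, smul_zero], hu⟩
    · rw [hR _ (c⁻¹ • x) (by rw [hWz]; exact ⟨hu0, hu⟩), smul_smul, mul_inv_cancel₀ hc, one_smul]

theorem rowSel_mulVec {m n : ℕ} (p : ℕ) (hp : p < m) (z : Fin m × Fin n → ℂ) :
    rowSel m n ((p : ℤ) + 1) *ᵥ z = blk z p := by
  funext a
  simp only [Matrix.mulVec, dotProduct, Fintype.sum_prod_type, rowSel, blk, hp, dite_true]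
  rw [Finset.sum_eq_single (⟨p, hp⟩ : Fin m)]
  · simp
  · intro q _ hq
    have : (q : ℕ) ≠ p := fun h => hq (Fin.ext h)
    simp [this]
  · simp

theorem runLen_skip (t : SIdx) (a b : List SIdx) (h : t ∉ a) :
    runLen t (a ++ b) = runLen t b := by
  induction a with
  | nil => rfl
  | cons k a ih =>
    have : ¬ k = t := fun e => h (by simp [e])
    simp only [List.cons_append, runLen, this, if_false]
    exact ih fun h' => h (by simp [h'])

theorem chainUp_length (p : ℕ) : ∀ t, (chainUp t p).length = p + 1 := by
  induction p with
  | zero => intro t; rfl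
  | succ p ih => intro t; simp [chainUp, ih]

/-! ### Facts about EGFP data -/

namespace EGFPData

variable {m n : ℕ} (E : EGFPData m n)

theorem sig_le {k : SIdx} (h : k ∈ E.sig) : k.val ≤ m := by
  have : k.val ∈ List.range (m + 1) :=
    E.hperm.mem_iff.mp (List.mem_append_left _ (List.mem_map_of_mem h))
  simp at this; omega

theorem tau_le {k : SIdx} (h : k ∈ E.tau) : k.val ≤ m := by
  have : k.val ∈ List.range (m + 1) :=
    E.hperm.mem_iff.mp (List.mem_append_right _ (List.mem_map_of_mem h))
  simp at this; omega

theorem nodup_all : (E.sig.map SIdx.val ++ E.tau.map SIdx.val).Nodup :=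
  E.hperm.nodup_iff.mpr List.nodup_range

theorem tau_nodup : E.tau.Nodup := (List.nodup_append.mp E.nodup_all).2.1.of_map

theorem not_both {i : ℕ} (h1 : SIdx.pos i ∈ E.sig) (h2 : SIdx.neg i ∈ E.tau) : False :=
  (List.nodup_append.mp E.nodup_all).2.2 i (List.mem_map_of_mem (f := SIdx.val) h1) i
    (List.mem_map_of_mem (f := SIdx.val) h2) rfl

theorem tau_neg {k : SIdx} (h : k ∈ E.tau) : ∃ i, k = .neg i ∧ i ≤ m := by
  have h1 := E.htauneg k h
  have h2 := E.tau_le h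
  cases k with
  | pos i => simp [SIdx.isNeg] at h1
  | neg i => exact ⟨i, rfl, h2⟩

theorem sig_pos {k : SIdx} (h : k ∈ E.sig) : ∃ i, k = .pos i ∧ i ≤ m := by
  have h1 := E.hsigpos k h
  have h2 := E.sig_le h
  cases k with
  | pos i => exact ⟨i, rfl, h2⟩
  | neg i => simp [SIdx.isNeg] at h1

theorem isUnit_assign (hm : 2 ≤ m) {t : List SIdx} {Xs : List (Matrix (Fin n) (Fin n) ℂ)}
    (ht : ∀ k ∈ t, k.val ≤ m) (h : NonsingAssign m t Xs) : IsUnit (prodAssign m n t Xs) := by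
  apply isUnit_elemProd hm
  intro k hk
  exact ⟨ht _ (List.of_mem_zip (a := k.1) (b := k.2) hk).1, h.2 k hk⟩

theorem isUnit_leftFac : IsUnit E.leftFac :=
  (isUnit_assign E.hm (fun k hk => E.tau_le (E.htau1 k hk).1) E.hY1).mul
    (isUnit_assign E.hm (fun k hk => E.sig_le (E.hsig1 k hk).1) E.hX1)

theorem isUnit_rightFac : IsUnit E.rightFac :=
  (isUnit_assign E.hm (fun k hk => E.sig_le (E.hsig2 k hk).1) E.hX2).mul
    (isUnit_assign E.hm (fun k hk => E.tau_le (E.htau2 k hk).1) E.hY2)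

/-- Fiedler pairs of a list of indices. -/
noncomputable def fp (l : List SIdx) : List (SIdx × Matrix (Fin n) (Fin n) ℂ) :=
  l.map fun k => (k, fiedlerX m E.A k)

theorem fp_fst (l : List SIdx) : (E.fp l).map Prod.fst = l := by
  simp [fp, Function.comp_def]

theorem prodFiedler_eq (l : List SIdx) : prodFiedler m n E.A l = elemProd m n (E.fp l) := by
  simp [prodFiedler, elemProd, fp, Function.comp_def]

theorem fiedler_unit (h : SIdx.neg 0 ∈ E.tau) : IsUnit (fiedlerX m E.A (.neg 0)) := by
  simp only [fiedlerX, if_true]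
  exact Matrix.isUnit_nonsing_inv_iff.mpr (E.hA0 h).neg

theorem isUnit_fp (l : List SIdx) (hl : ∀ k ∈ l, k ∈ E.tau) (hlm : SIdx.neg m ∉ l) :
    IsUnit (elemProd m n (E.fp l)) := by
  apply isUnit_elemProd E.hm
  intro k hk
  obtain ⟨t, ht, rfl⟩ := List.mem_map.mp hk
  obtain ⟨i, rfl, hi⟩ := E.tau_neg (hl t ht)
  refine ⟨hi, ?_⟩
  rintro (h | h)
  · simp only [SIdx.val] at h
    subst h
    exact E.fiedler_unit (hl _ ht)
  · simp only [SIdx.val] at h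
    subst h
    exact absurd ht hlm

/-- Splitting of `τ` at `−m`. -/
theorem tau_split (hτm : SIdx.neg m ∈ E.tau) : ∃ pre post,
    E.tau = pre ++ SIdx.neg m :: post ∧ SIdx.neg m ∉ pre ∧ SIdx.neg m ∉ post := by
  obtain ⟨pre, post, h⟩ := List.append_of_mem hτm
  have hn := E.tau_nodup
  rw [h, List.nodup_append, List.nodup_cons] at hn
  exact ⟨pre, post, h, fun hp => hn.2.2 _ hp _ (by simp) rfl, hn.2.1.1⟩

theorem ker_L1 {pre post : List SIdx} (h : E.tau = pre ++ SIdx.neg m :: post)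
    (hpre : SIdx.neg m ∉ pre) (z : Fin m × Fin n → ℂ) :
    E.L1 *ᵥ z = 0 ↔ E.A m *ᵥ blk ((elemProd m n (E.fp post) * E.rightFac) *ᵥ z) 0 = 0 ∧
      ∀ j, 0 < j → j < m → blk ((elemProd m n (E.fp post) * E.rightFac) *ᵥ z) j = 0 := by
  have hm := E.hm
  set W := elemProd m n (E.fp post) * E.rightFac with hW
  have hU : IsUnit (E.leftFac * elemProd m n (E.fp pre)) := by
    refine E.isUnit_leftFac.mul (E.isUnit_fp pre ?_ hpre)
    intro k hk; rw [h]; simp [hk]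
  have hL : E.L1 = (E.leftFac * elemProd m n (E.fp pre)) *
      (elemMat m n (.neg m) (E.A m) * W) := by
    have e : E.fp (pre ++ SIdx.neg m :: post)
        = E.fp pre ++ (SIdx.neg m, E.A m) :: E.fp post := by
      simp [fp, fiedlerX, show m ≠ 0 by omega]
    rw [L1, prodFiedler_eq, h, e, elemProd_append, elemProd_cons, hW]
    simp only [Matrix.mul_assoc]
  have hf := fun j hj => blk_elem_m hm (.neg m) rfl (E.A m) (W *ᵥ z) j hj
  have h1 : E.L1 *ᵥ z = 0 ↔ elemMat m n (.neg m) (E.A m) *ᵥ (W *ᵥ z) = 0 := by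
    rw [hL, ← Matrix.mulVec_mulVec, ← Matrix.mulVec_mulVec z]
    constructor
    · exact fun h => ker_of_isUnit hU h
    · intro h; rw [h, Matrix.mulVec_zero]
  rw [h1]
  constructor
  · intro h0
    rw [h0] at hf
    simp only [blk_zero] at hf
    constructor
    · simpa using (hf 0 (by omega)).symm
    · intro j hj hjm
      have := (hf j hjm).symm
      rwa [if_neg (by omega)] at this
  · rintro ⟨e1, e2⟩
    apply blk_ext
    intro j hj
    rw [blk_zero, hf j hj]
    split_ifs with hj0
    · subst hj0; exact e1
    · exact e2 j (by omega) hj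

theorem isUnit_W {pre post : List SIdx} (h : E.tau = pre ++ SIdx.neg m :: post)
    (hpost : SIdx.neg m ∉ post) : IsUnit (elemProd m n (E.fp post) * E.rightFac) := by
  refine (E.isUnit_fp post ?_ hpost).mul E.isUnit_rightFac
  intro k hk; rw [h]; simp [hk]

theorem neg_m_succ (hm : 2 ≤ m) : (SIdx.neg m).succ = .neg (m - 1) := by
  obtain ⟨q, rfl⟩ : ∃ q, m = q + 1 := ⟨m - 1, by omega⟩
  rfl

theorem consAt_split (hm : 2 ≤ m) {pre post : List SIdx} (hpre : SIdx.neg m ∉ pre) :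
    consAt (pre ++ SIdx.neg m :: post) (.neg m) = runLen (.neg (m - 1)) post := by
  rw [consAt_eq, runLen_skip _ _ _ hpre]
  simp [runLen, neg_m_succ hm]

theorem W_mulVec (post : List SIdx) (z : Fin m × Fin n → ℂ) :
    (elemProd m n (E.fp post) * E.rightFac) *ᵥ z =
    elemProd m n (E.fp post) *ᵥ (elemProd m n (E.sig2.zip E.X2) *ᵥ
      (elemProd m n (E.tau2.zip E.Y2) *ᵥ z)) := by
  simp only [Matrix.mulVec_mulVec, Matrix.mul_assoc]
  rfl

theorem right_a (hτm : SIdx.neg m ∈ E.tau) {k : ℕ} (Z : Matrix (Fin m × Fin n) (Fin k) ℂ)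
    (hZ : ColsBasisKerRight E.L1 Z) (hc : consAt E.tau (.neg m) < (m : ℤ)) :
    ColsBasisKerRight (E.A m) (rowSel m n (consAt (E.tau ++ E.tau2) (.neg m) + 1) * Z) := by
  have hm := E.hm
  obtain ⟨pre, post, h, hpre, hpost⟩ := E.tau_split hτm
  have hsub : ∀ k ∈ post, k ∈ E.tau := by intro k hk; rw [h]; simp [hk]
  set p1 := runLen (.neg (m - 1)) post with hp1
  set r2 := runLen (.neg (m - 1 - p1)) E.tau2 with hr2
  have hp1m : p1 < m := by
    rw [h, consAt_split hm hpre] at hc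
    exact_mod_cast hc
  have hp2m : p1 + r2 < m := by
    by_contra hcon
    have := runLen_mem E.tau2 (m - 1 - p1) (m - 1 - p1) (by omega) le_rfl
    have := (E.htau2 _ this).2
    simp [SIdx.val] at this
  have hc2 : consAt (E.tau ++ E.tau2) (.neg m) = ((p1 + r2 : ℕ) : ℤ) := by
    rw [h, List.append_assoc, List.cons_append, consAt_split hm hpre,
      runLen_append _ _ _ (by omega)]
  have hbig : ∀ i, m - p1 ≤ i → i ≤ m → SIdx.neg i ∈ E.tau := by
    intro i h1 h2
    rcases Nat.eq_or_lt_of_le h2 with rfl | h3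
    · exact hτm
    · have := runLen_mem post (m - 1) (m - 1 - i) (by omega) (by omega)
      have e : m - 1 - (m - 1 - i) = i := by omega
      rw [e] at this
      exact hsub _ this
  have hs0 : SIPL (E.tau ++ E.tau2) := by
    have := E.hSIPtau.toL
    rw [List.append_assoc] at this
    exact this.tail
  rw [h, List.append_assoc, List.cons_append] at hs0
  have hg : Guard (.neg m) (post ++ E.tau2) := hs0 pre _ _ rfl
  have hs1 : SIPL (post ++ E.tau2) := by
    refine SIPL.tail (a := pre ++ [SIdx.neg m]) ?_
    simpa using hs0
  have hs2 : SIPL (E.tau2 ++ []) := by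
    rw [List.append_nil]; exact hs1.tail
  have hfst : (E.tau2.zip E.Y2).map Prod.fst = E.tau2 :=
    List.map_fst_zip (le_of_eq E.hY2.1)
  rw [hc2]
  refine basis_of_core hm E.L1 _ _ _ Z (E.isUnit_W h hpost) (E.ker_L1 h hpre) 1 one_ne_zero ?_ hZ
  intro z x hx
  rw [W_mulVec] at hx
  have a1 := neg_run hm E.tau2 (E.fp post) 0 _ (by
      intro k hk
      obtain ⟨t, ht, rfl⟩ := List.mem_map.mp hk
      obtain ⟨i, rfl, hi⟩ := E.tau_neg (hsub t ht)
      refine ⟨i, rfl, hi, ?_⟩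
      rintro rfl
      exact E.fiedler_unit (hsub _ ht)) (by rw [fp_fst]; exact hs1)
      (by rw [fp_fst]; exact hg) (by rw [fp_fst, Nat.sub_zero]; omega) hx
  rw [fp_fst, Nat.sub_zero, Nat.zero_add, ← hp1] at a1
  obtain ⟨a1, g1⟩ := a1
  have a2 := pos_run (E.sig2.zip E.X2) _ (by
      intro k hk
      have hk2 := (List.of_mem_zip (a := k.1) (b := k.2) hk).1
      obtain ⟨hks, hkm⟩ := E.hsig2 _ hk2
      obtain ⟨i, hi, him⟩ := E.sig_pos hks
      refine ⟨i, hi, ?_, ?_⟩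
      · rw [hi] at hk2 hks hkm
        simp only [SIdx.val] at hkm
        by_contra hcon
        by_cases h1 : m - p1 ≤ i
        · exact E.not_both hks (hbig i h1 him)
        · obtain ⟨s1, s2, es⟩ := List.append_of_mem hks
          obtain ⟨t1, t2, et⟩ := List.append_of_mem hk2
          have hmem := E.hSIPsig.toL (E.sig1 ++ s1) (.pos i) (s2 ++ E.sig2) (by simp [es])
            (s2 ++ t1) t2 (by simp [et])
          have hmem' : SIdx.pos (i + 1) ∈ E.sig := by
            rcases List.mem_append.mp hmem with h' | h'
            · rw [es]; exact List.mem_append_right _ (List.mem_cons_of_mem _ h')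
            · exact (E.hsig2 _ (by rw [et]; exact List.mem_append_left _ h')).1
          exact E.not_both hmem' (hbig (i + 1) (by omega) (by omega))
      · rintro rfl
        exact E.hX2.2 k hk (Or.inl (by rw [hi]; rfl))) a1
  have a3 := neg_run hm [] (E.tau2.zip E.Y2) p1 _ (by
      intro k hk
      have hk2 := (List.of_mem_zip (a := k.1) (b := k.2) hk).1
      obtain ⟨i, hi, him⟩ := E.tau_neg (E.htau2 _ hk2).1
      refine ⟨i, hi, him, ?_⟩
      rintro rfl
      exact E.hY2.2 k hk (Or.inl (by rw [hi]; rfl))) (by rw [hfst]; exact hs2)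
      (by rw [hfst, List.append_nil]; exact g1) (by rw [hfst]; exact hp2m) a2
  rw [hfst, ← hr2] at a3
  rw [rowSel_mulVec _ hp2m, one_smul]
  exact a3.1.1

theorem right_b (hτm : SIdx.neg m ∈ E.tau) {k : ℕ} (Z : Matrix (Fin m × Fin n) (Fin k) ℂ)
    (hZ : ColsBasisKerRight E.L1 Z) (hc : consAt E.tau (.neg m) = (m : ℤ)) :
    ColsBasisKerRight (E.A m) ((E.A 0)⁻¹ * rowSel m n (m : ℤ) * Z) := by
  have hm := E.hm
  obtain ⟨pre, post, h, hpre, hpost⟩ := E.tau_split hτm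
  have hsub : ∀ k ∈ post, k ∈ E.tau := by intro k hk; rw [h]; simp [hk]
  rw [h, consAt_split hm hpre] at hc
  have hp1 : runLen (.neg (m - 1)) post = m := by exact_mod_cast hc
  have h0 : SIdx.neg 0 ∈ E.tau := by
    have := runLen_mem post (m - 1) (m - 1) (by omega) le_rfl
    rw [Nat.sub_self] at this
    exact hsub _ this
  have hA := E.hA0 h0
  have hch : (chainUp (.neg (m - 1)) (m - 1)).Sublist post := by
    rw [chain_sublist_iff]; omega
  have hlen := E.hperm.length_eq
  rw [h] at hlen
  simp only [List.length_append, List.length_map, List.length_cons, List.length_range] at hlen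
  have hl1 := hch.length_le
  rw [chainUp_length] at hl1
  have hpe : chainUp (.neg (m - 1)) (m - 1) = post :=
    hch.eq_of_length_le (by rw [chainUp_length]; omega)
  have hsig : E.sig = [] := List.length_eq_zero_iff.mp (by omega)
  have hsig2 : E.sig2 = [] := by
    rw [List.eq_nil_iff_forall_not_mem]
    intro k hk
    have := (E.hsig2 k hk).1
    rw [hsig] at this
    simp at this
  refine basis_of_core hm E.L1 _ _ _ Z (E.isUnit_W h hpost) (E.ker_L1 h hpre) (-1)
    (by norm_num) ?_ hZ
  intro z x hx
  rw [W_mulVec, hsig2] at hx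
  simp only [List.zip_nil_left] at hx
  have e1 : elemProd m n [] = 1 := by simp [elemProd]
  rw [e1, Matrix.one_mulVec] at hx
  have b1 := chain_run E.A hA (m - 1) (elemProd m n (E.tau2.zip E.Y2) *ᵥ z) (by omega)
  rw [hpe, Nat.sub_self] at b1
  have b2 := hx.1
  rw [fp] at b2
  rw [b2, last_run hm] at b1
  · have e : (m : ℤ) = ((m - 1 : ℕ) : ℤ) + 1 := by omega
    rw [← Matrix.mulVec_mulVec, e, rowSel_mulVec _ (by omega), b1, Matrix.mulVec_neg,
      Matrix.mulVec_mulVec, Matrix.nonsing_inv_mul _ ((Matrix.isUnit_iff_isUnit_det _).mp hA),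
      Matrix.one_mulVec, neg_one_smul]
  · intro k hk
    have hk2 := (List.of_mem_zip (a := k.1) (b := k.2) hk).1
    obtain ⟨i, hi, him⟩ := E.tau_neg (E.htau2 _ hk2).1
    have := (E.htau2 _ hk2).2
    rw [hi] at this
    exact ⟨i, hi, him, this⟩

/-! ### Transposition -/

/-- Transposing and reversing a matrix assignment. -/
def trList (Xs : List (Matrix (Fin n) (Fin n) ℂ)) : List (Matrix (Fin n) (Fin n) ℂ) :=
  (Xs.map Matrix.transpose).reverse

theorem zip_tr (t : List SIdx) (Xs : List (Matrix (Fin n) (Fin n) ℂ))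
    (h : t.length = Xs.length) :
    t.reverse.zip (trList Xs) = ((t.zip Xs).map fun p => (p.1, p.2ᵀ)).reverse := by
  rw [trList, List.zip_eq_zipWith, List.zip_eq_zipWith,
    ← List.reverse_zipWith (by simpa using h), List.zipWith_map_right, List.map_zipWith]

theorem nonsing_tr {t : List SIdx} {Xs : List (Matrix (Fin n) (Fin n) ℂ)}
    (h : NonsingAssign m t Xs) : NonsingAssign m t.reverse (trList Xs) := by
  refine ⟨by simpa [trList] using h.1, ?_⟩
  intro p hp
  rw [zip_tr t Xs h.1, List.mem_reverse] at hp
  obtain ⟨q, hq, rfl⟩ := List.mem_map.mp hp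
  intro hv
  exact (Matrix.isUnit_transpose _).mpr (h.2 q hq hv)

theorem elemProd_tr (l : List (SIdx × Matrix (Fin n) (Fin n) ℂ)) :
    (elemProd m n l)ᵀ = elemProd m n (l.map fun p => (p.1, p.2ᵀ)).reverse := by
  simp only [elemProd, Matrix.transpose_list_prod, List.map_reverse, List.map_map,
    Function.comp_def, elemMat_transpose]

theorem prodAssign_tr {t : List SIdx} {Xs : List (Matrix (Fin n) (Fin n) ℂ)}
    (h : t.length = Xs.length) :
    (prodAssign m n t Xs)ᵀ = prodAssign m n t.reverse (trList Xs) := by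
  have := elemProd_tr (m := m) (t.zip Xs)
  rw [← zip_tr t Xs h] at this
  exact this

theorem fiedlerX_tr (A : ℕ → Matrix (Fin n) (Fin n) ℂ) (k : SIdx) :
    (fiedlerX m A k)ᵀ = fiedlerX m (fun i => (A i)ᵀ) k := by
  cases k <;> simp only [fiedlerX] <;> split_ifs <;>
    simp [Matrix.transpose_nonsing_inv]

theorem prodFiedler_tr (A : ℕ → Matrix (Fin n) (Fin n) ℂ) (t : List SIdx) :
    (prodFiedler m n A t)ᵀ = prodFiedler m n (fun i => (A i)ᵀ) t.reverse := by
  simp only [prodFiedler, Matrix.transpose_list_prod, List.map_reverse, List.map_map,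
    Function.comp_def, elemMat_transpose, fiedlerX_tr]

/-- The transposed EGFP data. -/
noncomputable def tr : EGFPData m n where
  A := fun i => (E.A i)ᵀ
  sig := E.sig.reverse
  tau := E.tau.reverse
  sig1 := E.sig2.reverse
  sig2 := E.sig1.reverse
  tau1 := E.tau2.reverse
  tau2 := E.tau1.reverse
  X1 := trList E.X2
  X2 := trList E.X1
  Y1 := trList E.Y2
  Y2 := trList E.Y1
  hm := E.hm
  hAm := fun h => E.hAm (by simpa using h)
  hsigpos := fun k hk => E.hsigpos k (by simpa using hk)
  htauneg := fun k hk => E.htauneg k (by simpa using hk)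
  hperm := by
    rw [List.map_reverse, List.map_reverse]
    exact ((List.reverse_perm _).append (List.reverse_perm _)).trans E.hperm
  hsig1 := fun k hk => by simpa using E.hsig2 k (by simpa using hk)
  hsig2 := fun k hk => by simpa using E.hsig1 k (by simpa using hk)
  htau1 := fun k hk => by simpa using E.htau2 k (by simpa using hk)
  htau2 := fun k hk => by simpa using E.htau1 k (by simpa using hk)
  hSIPsig := by simpa using E.hSIPsig.rev
  hSIPtau := by simpa using E.hSIPtau.rev
  hX1 := nonsing_tr E.hX2
  hX2 := nonsing_tr E.hX1
  hY1 := nonsing_tr E.hY2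
  hY2 := nonsing_tr E.hY1
  hA0 := fun h => (Matrix.isUnit_transpose _).mpr (E.hA0 (by simpa using h))
  hAmUnit := fun h => (Matrix.isUnit_transpose _).mpr (E.hAmUnit (by simpa using h))

theorem tr_L1 : E.tr.L1 = E.L1ᵀ := by
  simp only [L1, leftFac, rightFac, Matrix.transpose_mul, prodFiedler_tr,
    prodAssign_tr E.hX1.1, prodAssign_tr E.hX2.1, prodAssign_tr E.hY1.1, prodAssign_tr E.hY2.1]
  simp only [tr, Matrix.mul_assoc]

end EGFPData

theorem left_iff {α β : Type*} [Fintype α] {k : ℕ} (M : Matrix α β ℂ) (Z : Matrix α (Fin k) ℂ) :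
    ColsBasisKerLeft M Z ↔ ColsBasisKerRight Mᵀ Z := by
  simp only [ColsBasisKerLeft, ColsBasisKerRight, Matrix.mulVec_transpose]

/-- **eigenvector recovery at the eigenvalue `∞`.**  Let
`L(λ) = λ L₁ − L₀` be an EGFP of the regular `P(λ)` with `∞` an eigenvalue of `P`
(`A_m` singular, hence `−m ∈ τ`).  If the columns of `Z` form a basis of the right
(resp. left) eigenspace `N_r(L₁)` (resp. `N_l(L₁)`) of `L(λ)` at `∞`, then the columns
of the indicated recovery products form a basis of `N_r(A_m)` (resp. `N_l(A_m)`). -/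
theorem egfp_infinite_eigenvector_recovery {m n : ℕ} (E : EGFPData m n)
    (hreg : (polyP m n E.A).det ≠ 0)
    (hAmsing : ¬ IsUnit (E.A m))
    (hτm : SIdx.neg m ∈ E.tau) :
    ∀ (k : ℕ) (Z : Matrix (Fin m × Fin n) (Fin k) ℂ),
      (ColsBasisKerRight E.L1 Z →
        (consAt E.tau (.neg m) < (m : ℤ) →
          ColsBasisKerRight (E.A m)
            (rowSel m n (consAt (E.tau ++ E.tau2) (.neg m) + 1) * Z)) ∧
        (consAt E.tau (.neg m) = (m : ℤ) →
          ColsBasisKerRight (E.A m) ((E.A 0)⁻¹ * rowSel m n (m : ℤ) * Z))) ∧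
      (ColsBasisKerLeft E.L1 Z →
        (invsAt E.tau (.neg m) < (m : ℤ) →
          ColsBasisKerLeft (E.A m)
            (rowSel m n (invsAt (E.tau1 ++ E.tau) (.neg m) + 1) * Z)) ∧
        (invsAt E.tau (.neg m) = (m : ℤ) →
          ColsBasisKerLeft (E.A m) (((E.A 0)⁻¹)ᵀ * rowSel m n (m : ℤ) * Z))) := by
  intro k Z
  refine ⟨fun hZ => ⟨E.right_a hτm Z hZ, E.right_b hτm Z hZ⟩, fun hZ => ?_⟩
  rw [left_iff, ← E.tr_L1] at hZ
  have hτm' : SIdx.neg m ∈ E.tr.tau := by simpa [EGFPData.tr] using hτm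
  constructor
  · intro hc
    rw [invsAt_eq] at hc
    have := E.tr.right_a hτm' Z hZ hc
    rw [left_iff, invsAt_eq, List.reverse_append]
    exact this
  · intro hc
    rw [invsAt_eq] at hc
    have := E.tr.right_b hτm' Z hZ hc
    rw [left_iff, Matrix.transpose_nonsing_inv]
    exact this
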